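/- arXiv:0909.4801 — 6 statements merged into one kernel-verified Lean document; each statement's English description precedes it below -/
import Mathlib

section
/- Let p = (p_1,…,p_d) be a probability vector. Consider any classical fine-grained measurement given by a finite outcome set R, an index map r ↦ i_r ∈ {1,…,d} and weights q_r ∈ [0,1] satisfying Σ_{r : i_r = i} q_r = 1 for every i ∈ {1,…,d}; the outcome distribution on R is (q_r p_{i_r})_{r∈R}. Then the Shannon entropy of this outcome distribution is at least H(p), and the infimum over all such measurements equals H(p) (it is attained by the measurement with R = {1,…,d}, i_r = r, q_r = 1). -/
open scoped BigOperators

/-- Shannon entropy (base 2) of a probability vector, with the convention `0 * log 0 = 0`. -/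
noncomputable def shannonH {α : Type*} [Fintype α] (q : α → ℝ) : ℝ :=
  -∑ a, q a * Real.logb 2 (q a)

/-- Shrinking a nonnegative `x` by a factor `c ∈ [0,1]` can only decrease its logarithm. -/
theorem mul_logb_two_mul_le {c x : ℝ} (hc : c ∈ Set.Icc (0 : ℝ) 1) (hx : 0 ≤ x) :
    c * x * Real.logb 2 (c * x) ≤ c * (x * Real.logb 2 x) := by
  rw [← mul_assoc]
  rcases (mul_nonneg hc.1 hx).eq_or_lt with h | h
  · simp [← h]
  · exact mul_le_mul_of_nonneg_left
      (Real.logb_le_logb_of_le one_lt_two h (mul_le_of_le_one_left hx hc.2)) h.le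

/-- Splitting each element of a probability vector into weighted pieces does not decrease the
Shannon entropy. -/
theorem shannonH_le_shannonH_refinement {α β : Type*} [Fintype α] [DecidableEq α] [Fintype β]
    (p : α → ℝ) (hp : ∀ i, 0 ≤ p i) (idx : β → α) (q : β → ℝ)
    (hq : ∀ r, q r ∈ Set.Icc (0 : ℝ) 1)
    (hsum : ∀ i, ∑ r ∈ Finset.univ.filter (fun r => idx r = i), q r = 1) :
    shannonH p ≤ shannonH (fun r => q r * p (idx r)) := by
  refine neg_le_neg ?_
  calc ∑ r, q r * p (idx r) * Real.logb 2 (q r * p (idx r))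
      ≤ ∑ r, q r * (p (idx r) * Real.logb 2 (p (idx r))) :=
        Finset.sum_le_sum fun r _ => mul_logb_two_mul_le (hq r) (hp (idx r))
    _ = ∑ i, ∑ r ∈ Finset.univ.filter (fun r => idx r = i),
          q r * (p (idx r) * Real.logb 2 (p (idx r))) :=
        (Finset.sum_fiberwise _ _ _).symm
    _ = ∑ i, p i * Real.logb 2 (p i) := by
        refine Finset.sum_congr rfl fun i _ => ?_
        rw [← one_mul (p i * Real.logb 2 (p i)), ← hsum i, Finset.sum_mul]
        refine Finset.sum_congr rfl fun r hr => ?_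
        rw [(Finset.mem_filter.mp hr).2]

/-- For a classical probability vector `p` on `{1,…,d}`, every classical
fine-grained measurement (finite outcome set `Fin m`, index map `idx`, weights `q r ∈ [0,1]`
with `∑_{r : idx r = i} q r = 1` for each `i`, outcome distribution `r ↦ q r * p (idx r)`)
has outcome Shannon entropy at least `H(p)`, and the infimum over all such measurements
equals `H(p)` and is attained. -/
theorem classical_fineGrained_entropy_isLeast {d : ℕ} (p : Fin d → ℝ)
    (hp0 : ∀ i, 0 ≤ p i) (hp1 : ∑ i, p i = 1) :
    (∀ (m : ℕ) (idx : Fin m → Fin d) (q : Fin m → ℝ),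
        (∀ r, q r ∈ Set.Icc (0 : ℝ) 1) →
        (∀ i, ∑ r ∈ Finset.univ.filter (fun r => idx r = i), q r = 1) →
        shannonH p ≤ shannonH (fun r => q r * p (idx r))) ∧
    IsLeast
      { x : ℝ | ∃ (m : ℕ) (idx : Fin m → Fin d) (q : Fin m → ℝ),
          (∀ r, q r ∈ Set.Icc (0 : ℝ) 1) ∧
          (∀ i, ∑ r ∈ Finset.univ.filter (fun r => idx r = i), q r = 1) ∧
          x = shannonH (fun r => q r * p (idx r)) }
      (shannonH p) := by
  have hle := fun (m : ℕ) (idx : Fin m → Fin d) (q : Fin m → ℝ) =>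
    shannonH_le_shannonH_refinement p hp0 idx q
  refine ⟨hle, ⟨d, id, fun _ => 1, by simp, by simp [Finset.filter_eq'], by simp⟩, ?_⟩
  rintro x ⟨m, idx, q, hq, hsum, rfl⟩
  exact hle m idx q hq hsum
end

section
/- Let ρ and σ be density matrices on ℂ^d. Then the supremum, over all POVMs {E_r}_{r∈R} (finite families of positive semidefinite operators with Σ_r E_r = I), of the classical statistical distance (1/2) Σ_{r∈R} |tr(E_r ρ) − tr(E_r σ)| between the two outcome distributions, equals (1/2)‖ρ − σ‖₁, half the trace norm of ρ − σ. -/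
open scoped BigOperators ComplexOrder

namespace Matrix

variable {n 𝕜 : Type*} [Fintype n] [DecidableEq n] [RCLike 𝕜]

/-- The trace of `M * A`, computed in an orthonormal eigenbasis of the Hermitian matrix `A`. -/
theorem IsHermitian.trace_mul_eq_sum_eigenvalues {A : Matrix n n 𝕜} (hA : A.IsHermitian)
    (M : Matrix n n 𝕜) :
    (M * A).trace = ∑ i,
      ((hA.eigenvectorUnitary : Matrix n n 𝕜)ᴴ * M * (hA.eigenvectorUnitary : Matrix n n 𝕜)) i i *
        (hA.eigenvalues i : 𝕜) := by
  conv_lhs => rw [hA.spectral_theorem, Unitary.conjStarAlgAut_apply]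
  rw [← mul_assoc, trace_mul_comm, ← mul_assoc, ← mul_assoc, trace]
  simp [mul_diagonal, star_eq_conjTranspose]

/-- A measurement `E` yields outcome values `tr (E r * A)` whose total absolute value is at most
the trace norm of the Hermitian matrix `A`. -/
theorem IsHermitian.sum_abs_re_trace_mul_le {A : Matrix n n ℂ} (hA : A.IsHermitian)
    {R : Type*} [Fintype R] {E : R → Matrix n n ℂ} (hE : ∀ r, (E r).PosSemidef)
    (hE1 : ∑ r, E r = 1) :
    ∑ r, |((E r * A).trace).re| ≤ ∑ i, |hA.eigenvalues i| := by
  set U : Matrix n n ℂ := ↑hA.eigenvectorUnitary with hU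
  have hUU : Uᴴ * U = 1 := Unitary.coe_star_mul_self hA.eigenvectorUnitary
  have hnonneg (r : R) (i : n) : 0 ≤ ((Uᴴ * E r * U) i i).re :=
    (Complex.le_def.1 ((hE r).conjTranspose_mul_mul_same U).diag_nonneg).1
  have hsum (i : n) : ∑ r, ((Uᴴ * E r * U) i i).re = 1 := by
    rw [← Complex.re_sum, ← sum_apply, ← Finset.sum_mul, ← Finset.mul_sum, hE1, mul_one, hUU,
      one_apply_eq, Complex.one_re]
  calc ∑ r, |((E r * A).trace).re|
      ≤ ∑ r, ∑ i, ((Uᴴ * E r * U) i i).re * |hA.eigenvalues i| := by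
        gcongr with r
        rw [hA.trace_mul_eq_sum_eigenvalues, ← hU, Complex.re_sum]
        refine (Finset.abs_sum_le_sum_abs _ _).trans_eq (Finset.sum_congr rfl fun i _ => ?_)
        rw [RCLike.ofReal_eq_complex_ofReal, Complex.re_mul_ofReal, abs_mul,
          abs_of_nonneg (hnonneg r i)]
    _ = ∑ i, |hA.eigenvalues i| := by
        rw [Finset.sum_comm]
        simp_rw [← Finset.sum_mul, hsum, one_mul]

/-- Measuring in an orthonormal eigenbasis of a Hermitian matrix reads off its eigenvalues. -/
theorem IsHermitian.exists_measurement_trace_mul_eq_eigenvalues {A : Matrix n n 𝕜}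
    (hA : A.IsHermitian) :
    ∃ E : n → Matrix n n 𝕜, (∀ i, (E i).PosSemidef) ∧ ∑ i, E i = 1 ∧
      ∀ i, (E i * A).trace = hA.eigenvalues i := by
  set U : Matrix n n 𝕜 := ↑hA.eigenvectorUnitary with hU
  have hUU : Uᴴ * U = 1 := Unitary.coe_star_mul_self hA.eigenvectorUnitary
  have hUU' : U * Uᴴ = 1 := Unitary.coe_mul_star_self hA.eigenvectorUnitary
  refine ⟨fun i => U * diagonal (Pi.single i 1) * Uᴴ, fun i => ?_, ?_, fun i => ?_⟩
  · refine (PosSemidef.diagonal ?_).mul_mul_conjTranspose_same U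
    exact Pi.single_nonneg.2 zero_le_one
  · have hdiag : ∑ i : n, diagonal (Pi.single i (1 : 𝕜)) = 1 := by
      simpa [Finset.univ_sum_single] using
        (map_sum (diagonalAddMonoidHom n 𝕜) (fun i => Pi.single i (1 : 𝕜)) Finset.univ).symm
    rw [← Finset.sum_mul, ← Finset.mul_sum, hdiag, mul_one, hUU']
  · rw [hA.trace_mul_eq_sum_eigenvalues, ← hU]
    have hconj : Uᴴ * (U * diagonal (Pi.single i 1) * Uᴴ) * U = diagonal (Pi.single i 1) := by
      rw [mul_assoc U, ← mul_assoc Uᴴ, hUU, one_mul, mul_assoc, hUU, mul_one]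
    simp [hconj, Pi.single_apply]

end Matrix

/-- For density matrices `ρ, σ` on `ℂ^d`, the supremum over all POVMs
`{E_r}` of the classical statistical distance `(1/2) ∑_r |tr(E_r ρ) − tr(E_r σ)|`
between the outcome distributions equals half the trace norm of `ρ − σ`, i.e. half the
sum of the absolute values of the eigenvalues of the Hermitian matrix `ρ − σ`. -/
theorem povm_statDistance_sSup_eq_traceDist {d : ℕ}
    (ρ σ : Matrix (Fin d) (Fin d) ℂ)
    (hρ : ρ.PosSemidef) (hρt : ρ.trace = 1)
    (hσ : σ.PosSemidef) (hσt : σ.trace = 1) :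
    sSup { x : ℝ | ∃ (N : ℕ) (E : Fin N → Matrix (Fin d) (Fin d) ℂ),
        (∀ r, (E r).PosSemidef) ∧ (∑ r, E r = 1) ∧
        x = (1 / 2) * ∑ r, |((E r * ρ).trace).re - ((E r * σ).trace).re| }
      = (1 / 2) * ∑ i, |(hρ.isHermitian.sub hσ.isHermitian).eigenvalues i| := by
  set hA := hρ.isHermitian.sub hσ.isHermitian
  have hsub (M : Matrix (Fin d) (Fin d) ℂ) :
      (M * ρ).trace.re - (M * σ).trace.re = (M * (ρ - σ)).trace.re := by
    rw [mul_sub, Matrix.trace_sub, Complex.sub_re]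
  simp_rw [hsub]
  refine IsGreatest.csSup_eq ⟨?_, ?_⟩
  · obtain ⟨E, hE, hE1, htr⟩ := hA.exists_measurement_trace_mul_eq_eigenvalues
    exact ⟨d, E, hE, hE1, by simp [htr]⟩
  · rintro x ⟨N, E, hE, hE1, rfl⟩
    gcongr
    exact hA.sum_abs_re_trace_mul_le hE hE1
end

section
/- Let P_PR be the PR-box: the conditional distribution on output pairs (a,b) ∈ {0,1}² given input pairs (x,y) ∈ {0,1}² with P_PR(a,b|x,y) = 1/2 if a ⊕ b = x·y and 0 otherwise. Then: (i) for every fixed input pair (x,y), each marginal output a and b is uniform on {0,1}, so the Shannon entropy of each marginal is 1; and (ii) for every adaptive measurement strategy consisting of a first input y_in ∈ {0,1} to the first subsystem and an input choice z_in = g(y_out) ∈ {0,1} for the second subsystem depending on the first output (for any g : {0,1} → {0,1}), the Shannon entropy of the joint outcome distribution (y_out, z_out) equals exactly 1. Hence, with Ĥ defined as the minimum outcome Shannon entropy over such fine-grained adaptive strategies, Ĥ(Y) = Ĥ(Z) = Ĥ(YZ) = 1. -/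
open scoped BigOperators

/-- The PR-box: conditional distribution on output pairs given input pairs,
`P(a,b|x,y) = 1/2` if `a ⊕ b = x ∧ y`, else `0`. -/
noncomputable def PR (inp : Bool × Bool) (out : Bool × Bool) : ℝ :=
  if xor out.1 out.2 = (inp.1 && inp.2) then 1 / 2 else 0

theorem sum_PR_snd (x y a : Bool) : ∑ b, PR (x, y) (a, b) = 1 / 2 := by
  cases x <;> cases y <;> cases a <;> simp [PR]

theorem sum_PR_fst (x y b : Bool) : ∑ a, PR (x, y) (a, b) = 1 / 2 := by
  cases x <;> cases y <;> cases b <;> simp [PR]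

theorem logb_two_half : Real.logb 2 (1 / 2) = -1 := by
  rw [one_div, Real.logb_inv, Real.logb_self_eq_one one_lt_two]

theorem shannonH_uniform_bool : shannonH (fun _ : Bool => (1 / 2 : ℝ)) = 1 := by
  simp only [shannonH, logb_two_half, Fintype.sum_bool]
  norm_num

theorem shannonH_PR_adaptive (y : Bool) (g : Bool → Bool) :
    shannonH (fun o : Bool × Bool => PR (y, g o.1) o) = 1 := by
  simp only [shannonH, Fintype.sum_prod_type, Fintype.sum_bool, PR]
  cases y <;> cases g true <;> cases g false <;> simp <;> norm_num

/-- (i) for every input pair, each marginal output of the PR-box is uniform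
(so its Shannon entropy is 1); (ii) every adaptive fine-grained strategy — a first input
`y` to the first box and an input `g(y_out)` to the second — has joint outcome entropy
exactly 1. Hence, with `Ĥ` the minimum outcome entropy over such strategies,
`Ĥ(Y) = Ĥ(Z) = Ĥ(YZ) = 1`. -/
theorem prBox_entropies :
    (∀ x y a, ∑ b, PR (x, y) (a, b) = 1 / 2) ∧
    (∀ x y b, ∑ a, PR (x, y) (a, b) = 1 / 2) ∧
    (∀ x y, shannonH (fun a => ∑ b, PR (x, y) (a, b)) = 1) ∧
    (∀ x y, shannonH (fun b => ∑ a, PR (x, y) (a, b)) = 1) ∧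
    (∀ (y : Bool) (g : Bool → Bool),
        shannonH (fun o : Bool × Bool => PR (y, g o.1) o) = 1) ∧
    IsLeast { h : ℝ | ∃ y : Bool, h = shannonH (fun a => ∑ b, PR (y, false) (a, b)) } 1 ∧
    IsLeast { h : ℝ | ∃ z : Bool, h = shannonH (fun b => ∑ a, PR (false, z) (a, b)) } 1 ∧
    IsLeast { h : ℝ | ∃ (y : Bool) (g : Bool → Bool),
        h = shannonH (fun o : Bool × Bool => PR (y, g o.1) o) } 1 := by
  have hfst (x y : Bool) : shannonH (fun a => ∑ b, PR (x, y) (a, b)) = 1 := by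
    simp only [sum_PR_snd, shannonH_uniform_bool]
  have hsnd (x y : Bool) : shannonH (fun b => ∑ a, PR (x, y) (a, b)) = 1 := by
    simp only [sum_PR_fst, shannonH_uniform_bool]
  refine ⟨sum_PR_snd, sum_PR_fst, hfst, hsnd, shannonH_PR_adaptive,
    ⟨⟨false, (hfst _ _).symm⟩, ?_⟩, ⟨⟨false, (hsnd _ _).symm⟩, ?_⟩,
    ⟨⟨false, id, (shannonH_PR_adaptive _ _).symm⟩, ?_⟩⟩
  · rintro _ ⟨y, rfl⟩
    exact (hfst _ _).ge
  · rintro _ ⟨z, rfl⟩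
    exact (hsnd _ _).ge
  · rintro _ ⟨y, g, rfl⟩
    exact (shannonH_PR_adaptive _ _).ge
end

section
/- Consider single binary-input binary-output boxes: states are functions P(a|x) with a,x ∈ {0,1}, P(a|x) ≥ 0, Σ_a P(a|x) = 1 for each x; the pure states are exactly the four deterministic boxes D_g (given by functions g : {0,1} → {0,1}, with D_g(a|x) = 1 iff a = g(x)); and define the decomposition entropy Ȟ(S) as the minimum, over probability weights (w_g)_g on the four deterministic boxes with Σ_g w_g D_g = S, of the Shannon entropy H(w). Let S₁ be the state with P(0|0) = 1, P(0|1) = 1/2, and S₂ the state with P(0|0) = 1/2, P(0|1) = 1. Then Ȟ(S₁) = Ȟ(S₂) = 1, whereas the equal mixture S_mix = (1/2)S₁ + (1/2)S₂ (with P(0|0) = P(0|1) = 3/4) satisfies Ȟ(S_mix) = H(3/4, 1/4) < 1. Hence Ȟ(S_mix) < (1/2)Ȟ(S₁) + (1/2)Ȟ(S₂), so the decomposition entropy Ȟ is not concave in box world. -/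
open scoped BigOperators

/-- The deterministic box associated with `g : {0,1} → {0,1}`:
`D_g(a|x) = 1` iff `a = g x`. These are the pure states of a single binary-input
binary-output box. -/
noncomputable def detBox (g : Bool → Bool) : Bool → Bool → ℝ :=
  fun x a => if a = g x then 1 else 0

/-- The set of Shannon entropies of weight vectors of decompositions of the single-box
state `S` into the four deterministic (pure) boxes; its infimum is the decomposition
entropy `Ȟ(S)`. -/
noncomputable def decompEntropies (S : Bool → Bool → ℝ) : Set ℝ :=
  { h : ℝ | ∃ w : (Bool → Bool) → ℝ,
      (∀ g, 0 ≤ w g) ∧ (∑ g, w g = 1) ∧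
      (∀ x a, ∑ g, w g * detBox g x a = S x a) ∧
      h = shannonH w }

/-- `S₁`: `P(0|0) = 1`, `P(0|1) = 1/2`. -/
noncomputable def S1 : Bool → Bool → ℝ :=
  fun x a => if x then 1 / 2 else (if a = false then 1 else 0)

/-- `S₂`: `P(0|0) = 1/2`, `P(0|1) = 1`. -/
noncomputable def S2 : Bool → Bool → ℝ :=
  fun x a => if x then (if a = false then 1 else 0) else 1 / 2

/-- `S_mix = (1/2)S₁ + (1/2)S₂`: `P(0|x) = 3/4` for both inputs. -/
noncomputable def Smix : Bool → Bool → ℝ :=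
  fun _ a => if a = false then 3 / 4 else 1 / 4

/-- The output distribution of a box on any fixed input has entropy at most that of the weights
of any decomposition of the box into deterministic ones. -/
theorem shannonH_le_of_mem_decompEntropies {S : Bool → Bool → ℝ} (x : Bool) {h : ℝ}
    (hh : h ∈ decompEntropies S) : shannonH (S x) ≤ h := by
  obtain ⟨w, hw, -, hS, rfl⟩ := hh
  unfold shannonH
  rw [neg_le_neg_iff]
  have hle (g : Bool → Bool) : w g ≤ S x (g x) := by
    rw [← hS]
    refine le_of_eq_of_le (by simp [detBox]) (Finset.single_le_sum
      (f := fun k => w k * detBox k x (g x)) (fun k _ => ?_) (Finset.mem_univ g))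
    exact mul_nonneg (hw k) (by unfold detBox; split_ifs <;> norm_num)
  calc ∑ g, w g * Real.logb 2 (w g)
      ≤ ∑ g, w g * Real.logb 2 (S x (g x)) := by
        refine Finset.sum_le_sum fun g _ => ?_
        rcases (hw g).eq_or_lt with h0 | hpos
        · simp [← h0]
        · gcongr
          · norm_num
          · exact hle g
    _ = ∑ g, ∑ a, w g * detBox g x a * Real.logb 2 (S x a) := by
        simp [detBox]
    _ = ∑ a, S x a * Real.logb 2 (S x a) := by
        rw [Finset.sum_comm]
        simp_rw [← Finset.sum_mul, hS]

theorem sum_bool_fun (F : (Bool → Bool) → ℝ) :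
    ∑ g, F g = ∑ a, ∑ b, F (fun x => bif x then b else a) := by
  rw [← (Equiv.boolArrowEquivProd Bool).symm.sum_comp, Fintype.sum_prod_type]
  refine Finset.sum_congr rfl fun a _ => Finset.sum_congr rfl fun b _ => congrArg F ?_
  ext x
  cases x <;> rfl

theorem isLeast_decompEntropies_S1 : IsLeast (decompEntropies S1) 1 := by
  refine ⟨⟨fun g => if g false then 0 else 1 / 2, fun g => ?_, ?_, fun x a => ?_, ?_⟩,
    fun h hh => ?_⟩
  · dsimp only; split_ifs <;> norm_num
  · norm_num [sum_bool_fun]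
  · cases x <;> cases a <;> norm_num [sum_bool_fun, detBox, S1]
  · norm_num [sum_bool_fun, shannonH, logb_two_half, -one_div]
  · refine le_of_eq_of_le ?_ (shannonH_le_of_mem_decompEntropies true hh)
    norm_num [shannonH, S1, logb_two_half, -one_div]

theorem isLeast_decompEntropies_S2 : IsLeast (decompEntropies S2) 1 := by
  refine ⟨⟨fun g => if g true then 0 else 1 / 2, fun g => ?_, ?_, fun x a => ?_, ?_⟩,
    fun h hh => ?_⟩
  · dsimp only; split_ifs <;> norm_num
  · norm_num [sum_bool_fun]
  · cases x <;> cases a <;> norm_num [sum_bool_fun, detBox, S2]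
  · norm_num [sum_bool_fun, shannonH, logb_two_half, -one_div]
  · refine le_of_eq_of_le ?_ (shannonH_le_of_mem_decompEntropies false hh)
    norm_num [shannonH, S2, logb_two_half, -one_div]

theorem isLeast_decompEntropies_Smix : IsLeast (decompEntropies Smix)
    (-(3 / 4 * Real.logb 2 (3 / 4)) - 1 / 4 * Real.logb 2 (1 / 4)) := by
  refine ⟨⟨fun g => if g false = g true then (if g true then 1 / 4 else 3 / 4) else 0,
    fun g => ?_, ?_, fun x a => ?_, ?_⟩, fun h hh => ?_⟩
  · dsimp only; split_ifs <;> norm_num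
  · norm_num [sum_bool_fun]
  · cases x <;> cases a <;> norm_num [sum_bool_fun, detBox, Smix]
  · simp [sum_bool_fun, shannonH, -one_div]
    ring
  · refine le_of_eq_of_le ?_ (shannonH_le_of_mem_decompEntropies false hh)
    simp [shannonH, Smix, -one_div]
    ring

theorem entropy_three_quarters_lt_one :
    -(3 / 4 * Real.logb 2 (3 / 4)) - 1 / 4 * Real.logb 2 (1 / 4) < 1 := by
  have h4 : Real.logb 2 4 = 2 := by
    rw [show (4 : ℝ) = 2 ^ 2 by norm_num, Real.logb_pow, Real.logb_self_eq_one one_lt_two]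
    norm_num
  have h3 : 4 < 3 * Real.logb 2 3 := by
    calc (4 : ℝ) = Real.logb 2 (2 ^ 4) := by
          rw [Real.logb_pow, Real.logb_self_eq_one one_lt_two]; norm_num
      _ < Real.logb 2 (3 ^ 3) := Real.logb_lt_logb one_lt_two (by norm_num) (by norm_num)
      _ = 3 * Real.logb 2 3 := by rw [Real.logb_pow]; norm_num
  rw [Real.logb_div three_ne_zero four_ne_zero, Real.logb_div one_ne_zero four_ne_zero,
    Real.logb_one, h4]
  linarith

/-- `Ȟ(S₁) = Ȟ(S₂) = 1`, while `Ȟ(S_mix) = H(3/4, 1/4) < 1`; hence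
`Ȟ(S_mix) < (1/2)Ȟ(S₁) + (1/2)Ȟ(S₂)`: the decomposition entropy is not concave in
box world. -/
theorem boxWorld_decompositionEntropy_not_concave :
    IsLeast (decompEntropies S1) 1 ∧
    IsLeast (decompEntropies S2) 1 ∧
    IsLeast (decompEntropies Smix)
      (-(3 / 4 * Real.logb 2 (3 / 4)) - 1 / 4 * Real.logb 2 (1 / 4)) ∧
    (-(3 / 4 * Real.logb 2 (3 / 4)) - 1 / 4 * Real.logb 2 (1 / 4) < 1) ∧
    sInf (decompEntropies Smix)
      < (1 / 2) * sInf (decompEntropies S1) + (1 / 2) * sInf (decompEntropies S2) := by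
  refine ⟨isLeast_decompEntropies_S1, isLeast_decompEntropies_S2, isLeast_decompEntropies_Smix,
    entropy_three_quarters_lt_one, ?_⟩
  rw [isLeast_decompEntropies_S1.csInf_eq, isLeast_decompEntropies_S2.csInf_eq,
    isLeast_decompEntropies_Smix.csInf_eq]
  linarith [entropy_three_quarters_lt_one]
end

section
/- Let ρ be a density matrix on ℂ^d with von Neumann entropy S(ρ) (the Shannon entropy of its eigenvalues). Then for every ε > 0 and δ > 0 there exists N such that for all n ≥ N there exists an orthogonal projection P on (ℂ^d)^{⊗n} with rank(P) ≤ 2^{n(S(ρ) + ε)} and tr(P ρ^{⊗n}) ≥ 1 − δ. In particular, the state ρ^{⊗n} can be confined, up to probability δ, to a subspace of dimension at most 2^{n(S(ρ)+ε)}. -/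
open scoped BigOperators ComplexOrder

open scoped Matrix

namespace Matrix

variable {ι m R : Type*} [Fintype ι]

/-- The tensor power of a square matrix, indexed by words `ι → m`. -/
def tensorPower [CommSemiring R] (ι : Type*) [Fintype ι] (A : Matrix m m R) :
    Matrix (ι → m) (ι → m) R :=
  .of fun s t => ∏ i, A (s i) (t i)

theorem tensorPower_mul [DecidableEq ι] [Fintype m] [CommSemiring R] (A B : Matrix m m R) :
    tensorPower ι (A * B) = tensorPower ι A * tensorPower ι B := by
  ext s t
  simp only [tensorPower, of_apply, mul_apply, Finset.prod_univ_sum, Fintype.piFinset_univ,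
    Finset.prod_mul_distrib]

theorem tensorPower_diagonal [DecidableEq m] [CommSemiring R] (q : m → R) :
    tensorPower ι (diagonal q) = diagonal fun s => ∏ i, q (s i) := by
  classical
  ext s t
  by_cases h : s = t
  · subst h
    simp [tensorPower]
  · obtain ⟨i, hi⟩ := Function.ne_iff.mp h
    rw [tensorPower, of_apply, diagonal_apply_ne _ h]
    exact Finset.prod_eq_zero (Finset.mem_univ i) (diagonal_apply_ne _ hi)

theorem tensorPower_one [DecidableEq m] [CommSemiring R] :
    tensorPower ι (1 : Matrix m m R) = 1 := by
  rw [← diagonal_one, tensorPower_diagonal]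
  simp

theorem conjTranspose_tensorPower [CommSemiring R] [StarRing R] (A : Matrix m m R) :
    (tensorPower ι A)ᴴ = tensorPower ι Aᴴ := by
  ext s t
  simp [tensorPower, conjTranspose_apply, star_prod]

end Matrix

section Moments

variable {α : Type*} [Fintype α]

theorem sum_fin_succ_fun (n : ℕ) (F : (Fin (n + 1) → α) → ℝ) :
    ∑ s, F s = ∑ a, ∑ s : Fin n → α, F (Fin.cons a s) := by
  rw [← Fintype.sum_prod_type', ← (Fin.consEquiv fun _ => α).sum_comp]
  rfl

theorem sum_prod_eq_one {q : α → ℝ} (hq : ∑ a, q a = 1) (n : ℕ) :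
    ∑ s : Fin n → α, ∏ i, q (s i) = 1 := by
  classical
  simpa [hq] using (Finset.sum_pow' Finset.univ q n).symm

theorem sum_prod_mul_sum_eq_zero {q X : α → ℝ} (hq : ∑ a, q a = 1) (hX : ∑ a, q a * X a = 0)
    (n : ℕ) : ∑ s : Fin n → α, (∏ i, q (s i)) * ∑ i, X (s i) = 0 := by
  induction n with
  | zero => simp
  | succ n ih =>
    rw [sum_fin_succ_fun]
    have key (a : α) : ∑ s : Fin n → α, (∏ i, q ((Fin.cons a s : Fin (n + 1) → α) i)) *
        ∑ i, X ((Fin.cons a s : Fin (n + 1) → α) i) = q a * X a := by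
      calc _ = q a * X a * (∑ s : Fin n → α, ∏ i, q (s i)) +
            q a * ∑ s : Fin n → α, (∏ i, q (s i)) * ∑ i, X (s i) := by
            rw [Finset.mul_sum, Finset.mul_sum, ← Finset.sum_add_distrib]
            refine Finset.sum_congr rfl fun s _ => ?_
            simp only [Fin.prod_univ_succ, Fin.sum_univ_succ, Fin.cons_zero, Fin.cons_succ]
            ring
        _ = _ := by rw [ih, sum_prod_eq_one hq]; ring
    simp_rw [key, hX]

theorem sum_prod_mul_sum_sq {q X : α → ℝ} (hq : ∑ a, q a = 1) (hX : ∑ a, q a * X a = 0)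
    (n : ℕ) :
    ∑ s : Fin n → α, (∏ i, q (s i)) * (∑ i, X (s i)) ^ 2 = n * ∑ a, q a * X a ^ 2 := by
  induction n with
  | zero => simp
  | succ n ih =>
    rw [sum_fin_succ_fun]
    have key (a : α) : ∑ s : Fin n → α, (∏ i, q ((Fin.cons a s : Fin (n + 1) → α) i)) *
        (∑ i, X ((Fin.cons a s : Fin (n + 1) → α) i)) ^ 2 =
        q a * X a ^ 2 + q a * (n * ∑ a, q a * X a ^ 2) := by
      calc _ = q a * X a ^ 2 * (∑ s : Fin n → α, ∏ i, q (s i)) +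
            2 * q a * X a * (∑ s : Fin n → α, (∏ i, q (s i)) * ∑ i, X (s i)) +
            q a * ∑ s : Fin n → α, (∏ i, q (s i)) * (∑ i, X (s i)) ^ 2 := by
            simp only [Finset.mul_sum (s := (Finset.univ : Finset (Fin n → α)))]
            rw [← Finset.sum_add_distrib, ← Finset.sum_add_distrib]
            refine Finset.sum_congr rfl fun s _ => ?_
            simp only [Fin.prod_univ_succ, Fin.sum_univ_succ, Fin.cons_zero, Fin.cons_succ]
            ring
        _ = _ := by rw [ih, sum_prod_mul_sum_eq_zero hq hX, sum_prod_eq_one hq]; ring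
    simp_rw [key]
    rw [Finset.sum_add_distrib, ← Finset.sum_mul, hq]
    push_cast
    ring

/-- Asymptotic equipartition: few words carry almost all of the mass of a product distribution. -/
theorem exists_typical_set {q : α → ℝ} (hq0 : ∀ a, 0 ≤ q a) (hq : ∑ a, q a = 1)
    {ε δ : ℝ} (hε : 0 < ε) (hδ : 0 < δ) :
    ∃ N : ℕ, ∀ n ≥ N, ∃ T : Finset (Fin n → α),
      (T.card : ℝ) ≤ (2 : ℝ) ^ ((n : ℝ) * (shannonH q + ε)) ∧
      1 - δ ≤ ∑ s ∈ T, ∏ i, q (s i) := by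
  classical
  set X : α → ℝ := fun a => Real.logb 2 (q a) + shannonH q with hXdef
  set V : ℝ := ∑ a, q a * X a ^ 2 with hV
  have hX : ∑ a, q a * X a = 0 := by
    simp only [hXdef, mul_add, Finset.sum_add_distrib, ← Finset.sum_mul, hq, shannonH]
    ring
  have hw (n : ℕ) (s : Fin n → α) : 0 ≤ ∏ i, q (s i) := Finset.prod_nonneg fun i _ => hq0 _
  obtain ⟨N, hN⟩ := exists_nat_gt (V / (ε ^ 2 * δ))
  refine ⟨N + 1, fun n hn => ?_⟩
  have hn0 : (0 : ℝ) < n := by exact_mod_cast (by omega : 0 < n)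
  have hnV : V / (ε ^ 2 * δ) ≤ n := hN.le.trans (by exact_mod_cast (by omega : N ≤ n))
  set b : ℝ := (2 : ℝ) ^ ((n : ℝ) * (shannonH q + ε)) with hb
  have hb0 : 0 < b := by positivity
  set T : Finset (Fin n → α) := {s | b⁻¹ ≤ ∏ i, q (s i)} with hT
  have hsplit := Finset.sum_add_sum_compl T fun s => ∏ i, q (s i)
  rw [sum_prod_eq_one hq] at hsplit
  refine ⟨T, ?_, ?_⟩
  · have h1 : T.card • b⁻¹ ≤ ∑ s ∈ T, ∏ i, q (s i) :=
      Finset.card_nsmul_le_sum _ _ _ fun s hs => by simpa [hT] using hs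
    have h2 : 0 ≤ ∑ s ∈ Tᶜ, ∏ i, q (s i) := Finset.sum_nonneg fun s _ => hw n s
    rw [nsmul_eq_mul, ← div_eq_mul_inv] at h1
    exact (div_le_one hb0).mp (by linarith)
  · have hdev : ∀ s ∈ Tᶜ, (∏ i, q (s i)) * (n * ε) ^ 2 ≤
        (∏ i, q (s i)) * (∑ i, X (s i)) ^ 2 := by
      intro s hs
      rcases (hw n s).eq_or_lt with h0 | h0
      · simp [← h0]
      refine mul_le_mul_of_nonneg_left ?_ h0.le
      have hne : ∀ i ∈ Finset.univ, q (s i) ≠ 0 := Finset.prod_ne_zero_iff.mp h0.ne'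
      have hlt : ∏ i, q (s i) < b⁻¹ := by simpa [hT] using hs
      have hlog := Real.logb_lt_logb one_lt_two h0 hlt
      rw [Real.logb_prod _ _ hne, Real.logb_inv, hb,
        Real.logb_rpow two_pos (by norm_num)] at hlog
      have hsum : ∑ i, X (s i) = ∑ i, Real.logb 2 (q (s i)) + n * shannonH q := by
        simp [hXdef, Finset.sum_add_distrib]
      have : 0 < n * ε := by positivity
      nlinarith
    have hcheb : (∑ s ∈ Tᶜ, ∏ i, q (s i)) * (n * ε) ^ 2 ≤ n * V := by
      rw [hV, ← sum_prod_mul_sum_sq hq hX, Finset.sum_mul]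
      exact (Finset.sum_le_sum hdev).trans (Finset.sum_le_univ_sum_of_nonneg fun s =>
        mul_nonneg (hw n s) (sq_nonneg _))
    have hVle : V ≤ n * (ε ^ 2 * δ) := (div_le_iff₀ (by positivity)).mp hnV
    have : ∑ s ∈ Tᶜ, ∏ i, q (s i) ≤ δ := by
      refine le_of_mul_le_mul_right (a := (n * ε) ^ 2) ?_ (by positivity)
      nlinarith
    linarith

end Moments

/-- typical subspace: for a density matrix `ρ` on `ℂ^d` with von Neumann
entropy `S(ρ)` (the Shannon entropy of its eigenvalues), for every `ε, δ > 0` there is `N`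
such that for all `n ≥ N` there is an orthogonal projection `P` on `(ℂ^d)^{⊗n}` with
`rank(P) ≤ 2^{n(S(ρ)+ε)}` and `tr(P ρ^{⊗n}) ≥ 1 − δ`. -/
theorem quantum_typical_subspace {d : ℕ}
    (ρ : Matrix (Fin d) (Fin d) ℂ)
    (hρ : ρ.PosSemidef) (htr : ρ.trace = 1)
    (ε δ : ℝ) (hε : 0 < ε) (hδ : 0 < δ) :
    ∃ N : ℕ, ∀ n ≥ N,
      ∃ P : Matrix (Fin n → Fin d) (Fin n → Fin d) ℂ,
        P.IsHermitian ∧ P * P = P ∧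
        (P.rank : ℝ) ≤
          (2 : ℝ) ^ ((n : ℝ) * (shannonH (fun i => hρ.isHermitian.eigenvalues i) + ε)) ∧
        1 - δ ≤ ((P * Matrix.of fun s t : Fin n → Fin d => ∏ i, ρ (s i) (t i)).trace).re := by
  classical
  set q := hρ.isHermitian.eigenvalues with hq
  have hsum : ∑ i, q i = 1 := by
    have h := hρ.isHermitian.trace_eq_sum_eigenvalues
    rw [htr] at h
    simpa using (congrArg Complex.re h).symm
  obtain ⟨N, hN⟩ := exists_typical_set hρ.eigenvalues_nonneg hsum hε hδ
  refine ⟨N, fun n hn => ?_⟩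
  obtain ⟨T, hcard, hmass⟩ := hN n hn
  set U : Matrix (Fin d) (Fin d) ℂ := hρ.isHermitian.eigenvectorUnitary.1 with hU
  have hUU : Uᴴ * U = 1 := Unitary.coe_star_mul_self hρ.isHermitian.eigenvectorUnitary
  have hspec : ρ = U * Matrix.diagonal (fun i => (q i : ℂ)) * Uᴴ := by
    conv_lhs => rw [hρ.isHermitian.spectral_theorem, Unitary.conjStarAlgAut_apply]
    rfl
  set W := Matrix.tensorPower (Fin n) U with hW
  have hWW : Wᴴ * W = 1 := by
    rw [hW, Matrix.conjTranspose_tensorPower, ← Matrix.tensorPower_mul, hUU,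
      Matrix.tensorPower_one]
  have hρn : Matrix.of (fun s t : Fin n → Fin d => ∏ i, ρ (s i) (t i)) =
      W * Matrix.diagonal (fun s => ∏ i, (q (s i) : ℂ)) * Wᴴ := by
    change Matrix.tensorPower (Fin n) ρ = _
    rw [hspec, Matrix.tensorPower_mul, Matrix.tensorPower_mul, Matrix.tensorPower_diagonal, hW,
      Matrix.conjTranspose_tensorPower]
  set D : Matrix (Fin n → Fin d) (Fin n → Fin d) ℂ :=
    Matrix.diagonal fun s => if s ∈ T then 1 else 0 with hD
  have hDD : D * D = D := by simp [hD]
  have hDh : Dᴴ = D := by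
    rw [hD, Matrix.diagonal_conjTranspose]
    congr 1
    ext s
    simp [apply_ite]
  refine ⟨W * D * Wᴴ, ?_, ?_, ?_, ?_⟩
  · simp [Matrix.IsHermitian, Matrix.conjTranspose_mul, hDh, Matrix.mul_assoc]
  · calc W * D * Wᴴ * (W * D * Wᴴ) = W * D * (Wᴴ * W) * D * Wᴴ := by
          simp only [Matrix.mul_assoc]
      _ = W * D * Wᴴ := by rw [hWW, Matrix.mul_one, Matrix.mul_assoc W D D, hDD]
  · refine le_trans ?_ hcard
    have hrank : D.rank = T.card := by
      rw [hD, Matrix.rank_diagonal]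
      simp
    rw [← hrank]
    exact_mod_cast (Matrix.rank_mul_le_left _ _).trans (Matrix.rank_mul_le_right _ _)
  · have htrace : (W * D * Wᴴ *
        (W * Matrix.diagonal (fun s : Fin n → Fin d => ∏ i, (q (s i) : ℂ)) * Wᴴ)).trace =
        ((∑ s ∈ T, ∏ i, q (s i) : ℝ) : ℂ) := by
      calc _ = (W * (D * (Wᴴ * W) *
              Matrix.diagonal (fun s : Fin n → Fin d => ∏ i, (q (s i) : ℂ)) * Wᴴ)).trace := by
            simp only [Matrix.mul_assoc]
        _ = (D * Matrix.diagonal (fun s : Fin n → Fin d => ∏ i, (q (s i) : ℂ))).trace := by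
            rw [Matrix.trace_mul_comm, Matrix.mul_assoc _ Wᴴ W, hWW, Matrix.mul_one,
              Matrix.mul_one]
        _ = _ := by simp [hD, Matrix.trace_diagonal]
    rw [hρn, htrace, Complex.ofReal_re]
    exact hmass
end

section
/- Let p be a probability distribution on a finite alphabet Σ with Shannon entropy H(p), and let R > H(p). Then for every ε > 0 there exists N such that for all n ≥ N there exist a finite set C with |C| ≤ 2^{nR}, an encoding map E : Σⁿ → C, and a decoding map D : C → Σⁿ, such that if X₁,…,X_n are i.i.d. with distribution p then the probability that D(E(X₁,…,X_n)) ≠ (X₁,…,X_n) is at most ε. That is, an i.i.d. source of entropy rate H(p) admits a reliable compression scheme at any rate R > H(p). -/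
open scoped BigOperators

/-- A set of at most `K` elements can be encoded losslessly with `K > 0` code words. -/
theorem exists_enc_dec_of_card_le {α : Type*} [Nonempty α] {T : Finset α} {K : ℕ} (hK : 0 < K)
    (hT : T.card ≤ K) :
    ∃ (enc : α → Fin K) (dec : Fin K → α), ∀ s ∈ T, dec (enc s) = s := by
  classical
  have : NeZero K := ⟨hK.ne'⟩
  obtain ⟨e⟩ : Nonempty (T ↪ Fin K) :=
    Function.Embedding.nonempty_of_card_le (by simpa using hT)
  let enc : α → Fin K := fun s => if h : s ∈ T then e ⟨s, h⟩ else 0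
  have henc : Set.InjOn enc T := by
    intro a ha b hb hab
    have ha' : a ∈ T := ha
    have hb' : b ∈ T := hb
    simpa [enc, ha', hb'] using hab
  exact ⟨enc, Function.invFunOn enc T, fun s hs => henc.leftInvOn_invFunOn hs⟩

/-- A probability vector on a nonempty type has nonnegative entropy. -/
theorem shannonH_nonneg {α : Type*} [Fintype α] {q : α → ℝ} (h0 : ∀ a, 0 ≤ q a)
    (h1 : ∑ a, q a = 1) : 0 ≤ shannonH q := by
  refine neg_nonneg.2 (Finset.sum_nonpos fun a _ => mul_nonpos_of_nonneg_of_nonpos (h0 a) ?_)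
  refine Real.logb_nonpos one_lt_two (h0 a) ?_
  exact h1 ▸ Finset.single_le_sum (fun b _ => h0 b) (Finset.mem_univ a)

/-- At most `c⁻¹` sequences have product probability at least `c`. -/
theorem card_filter_le_prod_le_inv {α : Type*} [Fintype α] {q : α → ℝ} (h0 : ∀ a, 0 ≤ q a)
    (h1 : ∑ a, q a = 1) (n : ℕ) {c : ℝ} (hc : 0 < c) :
    ((Finset.univ.filter fun s : Fin n → α => c ≤ ∏ i, q (s i)).card : ℝ) ≤ c⁻¹ := by
  classical
  rw [← one_div, le_div_iff₀ hc, ← nsmul_eq_mul]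
  calc _ ≤ ∑ s ∈ Finset.univ.filter fun s : Fin n → α => c ≤ ∏ i, q (s i), ∏ i, q (s i) :=
        Finset.card_nsmul_le_sum _ _ _ fun s hs => (Finset.mem_filter.1 hs).2
    _ ≤ ∑ s : Fin n → α, ∏ i, q (s i) :=
        Finset.sum_le_sum_of_subset_of_nonneg (Finset.filter_subset _ _)
          fun s _ _ => Finset.prod_nonneg fun i _ => h0 _
    _ = 1 := by rw [← Fintype.sum_pow, h1, one_pow]

/-- Above the entropy, the Chernoff exponent of the information content is negative for some
positive parameter. -/
theorem exists_sum_mul_exp_lt_one {α : Type*} [Fintype α] {q : α → ℝ} (h1 : ∑ a, q a = 1)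
    {R : ℝ} (hR : shannonH q < R) :
    ∃ t > 0, ∑ a, q a * Real.exp (-t * (Real.log (q a) + R * Real.log 2)) < 1 := by
  set f : ℝ → ℝ := fun t => ∑ a, q a * Real.exp (-t * (Real.log (q a) + R * Real.log 2)) with hf
  have hlog : 0 < Real.log 2 := Real.log_pos one_lt_two
  have hd : HasDerivAt f ((shannonH q - R) * Real.log 2) 0 := by
    have : HasDerivAt f (∑ a, q a * (Real.exp (-0 * (Real.log (q a) + R * Real.log 2)) *
        (-1 * (Real.log (q a) + R * Real.log 2)))) 0 :=
      HasDerivAt.fun_sum fun a _ => (((hasDerivAt_id (0 : ℝ)).neg.mul_const _).exp).const_mul _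
    convert this using 1
    have hterm : ∀ a, q a * (Real.exp (-0 * (Real.log (q a) + R * Real.log 2)) *
        (-1 * (Real.log (q a) + R * Real.log 2))) =
        -(q a * Real.logb 2 (q a)) * Real.log 2 - q a * (R * Real.log 2) := fun a => by
      rw [neg_zero, zero_mul, Real.exp_zero, Real.logb]
      field_simp
      ring
    rw [Finset.sum_congr rfl fun a _ => hterm a, Finset.sum_sub_distrib, ← Finset.sum_mul,
      ← Finset.sum_mul, h1, Finset.sum_neg_distrib, shannonH]
    ring
  have hneg : (shannonH q - R) * Real.log 2 < 0 := mul_neg_of_neg_of_pos (by linarith) hlog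
  have hslope := (hasDerivAt_iff_tendsto_slope.1 hd).eventually (gt_mem_nhds hneg)
  have hright := hslope.filter_mono (nhdsWithin_mono (0 : ℝ) (t := {0}ᶜ) (s := Set.Ioi 0)
    fun x hx => ne_of_gt hx)
  obtain ⟨t, hts, ht⟩ := (hright.and self_mem_nhdsWithin).exists
  have ht : 0 < t := ht
  refine ⟨t, ht, ?_⟩
  have hf0 : f 0 = 1 := by simp [hf, h1]
  rw [slope_def_field, sub_zero, div_neg_iff, hf0] at hts
  rcases hts with h | h
  · linarith [h.2]
  · change f t < 1
    linarith [h.1]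

/-- Chernoff bound for the probability of the sequences of product probability less than
`2 ^ (-n R)`. -/
theorem sum_prod_le_pow {α : Type*} [Fintype α] {q : α → ℝ} (h0 : ∀ a, 0 ≤ q a)
    (n : ℕ) {R t : ℝ} (ht : 0 < t) :
    (∑ s : Fin n → α, if ∏ i, q (s i) < (2 : ℝ) ^ (-((n : ℝ) * R)) then ∏ i, q (s i) else 0) ≤
      (∑ a, q a * Real.exp (-t * (Real.log (q a) + R * Real.log 2))) ^ n := by
  rw [Fintype.sum_pow]
  refine Finset.sum_le_sum fun s _ => ?_
  have hprod : 0 ≤ ∏ i, q (s i) := Finset.prod_nonneg fun i _ => h0 _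
  rw [Finset.prod_mul_distrib, ← Real.exp_sum, ← Finset.mul_sum]
  split_ifs with h
  · rcases hprod.eq_or_lt with hz | hpos
    · simp [← hz]
    · refine le_mul_of_one_le_right hprod (Real.one_le_exp ?_)
      have hlt := Real.log_lt_log hpos h
      rw [Real.log_rpow two_pos, Real.log_prod fun i hi =>
        Finset.prod_ne_zero_iff.1 hpos.ne' i hi] at hlt
      rw [Finset.sum_add_distrib, Finset.sum_const, Finset.card_univ, Fintype.card_fin,
        nsmul_eq_mul]
      nlinarith
  · positivity

/-- source coding: an i.i.d. source with distribution `p` of entropy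
`H(p)` admits a reliable compression scheme at any rate `R > H(p)`: for every `ε > 0`
there is `N` such that for all `n ≥ N` there exist a code of size `K ≤ 2^{nR}`, an
encoder `enc` and a decoder `dec` with error probability at most `ε`. -/
theorem source_coding_theorem {σ : Type*} [Fintype σ] [DecidableEq σ] (p : σ → ℝ)
    (hp0 : ∀ s, 0 ≤ p s) (hp1 : ∑ s, p s = 1)
    (R : ℝ) (hR : shannonH p < R) (ε : ℝ) (hε : 0 < ε) :
    ∃ N : ℕ, ∀ n ≥ N,
      ∃ (K : ℕ) (enc : (Fin n → σ) → Fin K) (dec : Fin K → (Fin n → σ)),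
        (K : ℝ) ≤ (2 : ℝ) ^ ((n : ℝ) * R) ∧
        (∑ s : Fin n → σ, if dec (enc s) ≠ s then ∏ i, p (s i) else 0) ≤ ε := by
  obtain ⟨t, ht, hlt⟩ := exists_sum_mul_exp_lt_one hp1 hR
  have hnn : 0 ≤ ∑ s, p s * Real.exp (-t * (Real.log (p s) + R * Real.log 2)) :=
    Finset.sum_nonneg fun s _ => mul_nonneg (hp0 s) (Real.exp_nonneg _)
  obtain ⟨N, hN⟩ := Filter.eventually_atTop.1
    ((tendsto_pow_atTop_nhds_zero_of_lt_one hnn hlt).eventually (gt_mem_nhds hε))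
  have hR0 : 0 ≤ R := (shannonH_nonneg hp0 hp1).trans hR.le
  have : Nonempty σ := by
    by_contra h
    rw [not_nonempty_iff] at h
    simp at hp1
  refine ⟨N, fun n hn => ?_⟩
  have hone : (1 : ℝ) ≤ (2 : ℝ) ^ ((n : ℝ) * R) :=
    Real.one_le_rpow one_le_two (by positivity)
  have hcard := card_filter_le_prod_le_inv hp0 hp1 n
    (c := (2 : ℝ) ^ (-((n : ℝ) * R))) (by positivity)
  rw [Real.rpow_neg two_pos.le, inv_inv] at hcard
  obtain ⟨enc, dec, h⟩ := exists_enc_dec_of_card_le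
    (Nat.floor_pos.2 hone) (Nat.le_floor hcard)
  refine ⟨_, enc, dec, Nat.floor_le (by positivity), ?_⟩
  refine le_trans (Finset.sum_le_sum fun s _ => ?_)
    ((sum_prod_le_pow hp0 n (R := R) ht).trans (hN n hn).le)
  have hprod : 0 ≤ ∏ i, p (s i) := Finset.prod_nonneg fun i _ => hp0 _
  by_cases hs : ∏ i, p (s i) < (2 : ℝ) ^ (-((n : ℝ) * R))
  · rw [if_pos hs]
    split_ifs
    exacts [le_rfl, hprod]
  · have hdec : dec (enc s) = s := h s <| Finset.mem_filter.2
      ⟨Finset.mem_univ _, by rwa [Real.rpow_neg two_pos.le, not_lt] at hs⟩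
    rw [if_neg hs, if_neg (not_not.2 hdec)]
end
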